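/- For every real γ > 0, writing Q(γ) := K_0(γ)/K_1(γ), the quantity I₃(γ) := γ²(1 − Q²)² − 11Q² − (9/γ)Q + 10 + 12/γ² is strictly positive. (This inequality is equivalent to (e+p)·e_pp − 2e_p(e_p − 1) < 0 along isentropes and establishes the genuine nonlinearity of the first and third characteristic fields of the relativistic Euler system for a diatomic gas with generalized Synge energy.) -/

import Mathlib

open MeasureTheory Real

/-- The modified Bessel function of the second kind, via the integral
representation `K_j(γ) = (2^j j!/(2j)!) γ^{-j} ∫_γ^∞ e^{-t}(t²-γ²)^{j-1/2} dt`. -/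
noncomputable def besselK (j : ℕ) (γ : ℝ) : ℝ :=
  ((2 : ℝ) ^ j * (Nat.factorial j) / (Nat.factorial (2 * j))) * γ ^ (-(j : ℝ)) *
    ∫ t in Set.Ioi γ, Real.exp (-t) * (t ^ 2 - γ ^ 2) ^ ((j : ℝ) - 1 / 2)

/-- The weight `e^{-t} (t²-γ²)^{-1/2}`. -/
noncomputable def wgt (γ t : ℝ) : ℝ := Real.exp (-t) * (t ^ 2 - γ ^ 2) ^ (-(1 / 2) : ℝ)

/-- Moments of the weight. -/
noncomputable def mom (γ : ℝ) (n : ℕ) : ℝ := ∫ t in Set.Ioi γ, t ^ n * wgt γ t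

lemma wgt_pos {γ t : ℝ} (hγ : 0 < γ) (ht : γ < t) : 0 < wgt γ t := by
  have : 0 < t ^ 2 - γ ^ 2 := by nlinarith
  unfold wgt
  positivity

lemma half_eq {γ t : ℝ} (hγ : 0 < γ) (ht : γ < t) :
    (t ^ 2 - γ ^ 2) ^ (1 / 2 : ℝ) = (t ^ 2 - γ ^ 2) * (t ^ 2 - γ ^ 2) ^ (-(1 / 2) : ℝ) := by
  have h : 0 < t ^ 2 - γ ^ 2 := by nlinarith
  nth_rewrite 2 [← Real.rpow_one (t ^ 2 - γ ^ 2)]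
  rw [← Real.rpow_add h]
  norm_num

lemma int_pow_exp (n : ℕ) : IntegrableOn (fun t : ℝ => t ^ n * Real.exp (-t)) (Set.Ioi 0) := by
  have h := Real.GammaIntegral_convergent (s := (n : ℝ) + 1) (by positivity)
  refine h.congr_fun (fun t _ => ?_) measurableSet_Ioi
  simp [mul_comm]

lemma wgt_cont {γ : ℝ} (hγ : 0 < γ) (n : ℕ) :
    ContinuousOn (fun t : ℝ => t ^ n * wgt γ t) (Set.Ioi γ) := by
  unfold wgt
  refine ContinuousOn.mul (by fun_prop) (ContinuousOn.mul (by fun_prop) ?_)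
  refine ContinuousOn.rpow_const (by fun_prop) ?_
  intro t ht
  left
  have : γ < t := ht
  nlinarith

lemma int_mom {γ : ℝ} (hγ : 0 < γ) (n : ℕ) :
    IntegrableOn (fun t : ℝ => t ^ n * wgt γ t) (Set.Ioi γ) := by
  have hm := (wgt_cont hγ n).aestronglyMeasurable (μ := volume) measurableSet_Ioi
  rw [← Set.Ioc_union_Ioi_eq_Ioi (by linarith : γ ≤ γ + 1), integrableOn_union]
  constructor
  · have h0 : IntervalIntegrable (fun x : ℝ => (x - γ) ^ (-(1 / 2) : ℝ)) volume γ (γ + 1) := by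
      have := (intervalIntegral.intervalIntegrable_rpow' (a := 0) (b := 1)
        (r := (-(1 / 2) : ℝ)) (by norm_num)).comp_sub_right γ
      simpa [add_comm] using this
    have h1 : ContinuousOn (fun x : ℝ => x ^ n * (Real.exp (-x) * (x + γ) ^ (-(1 / 2) : ℝ)))
        (Set.uIcc γ (γ + 1)) := by
      refine ContinuousOn.mul (by fun_prop) (ContinuousOn.mul (by fun_prop) ?_)
      refine ContinuousOn.rpow_const (by fun_prop) ?_
      intro t ht
      left
      rw [Set.uIcc_of_le (by linarith)] at ht
      have := ht.1
      linarith
    have h2 := h0.mul_continuousOn h1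
    rw [intervalIntegrable_iff_integrableOn_Ioc_of_le (by linarith)] at h2
    refine h2.congr_fun (fun t ht => ?_) measurableSet_Ioc
    have ht1 : γ < t := ht.1
    have e : t ^ 2 - γ ^ 2 = (t - γ) * (t + γ) := by ring
    simp only [wgt]
    rw [e, Real.mul_rpow (by linarith) (by linarith)]
    ring
  · have h := (int_pow_exp n).mono_set
      (Set.Ioi_subset_Ioi (by linarith : (0 : ℝ) ≤ γ + 1))
    refine Integrable.mono h
      (hm.mono_set (Set.Ioi_subset_Ioi (by linarith))) ?_
    refine (ae_restrict_iff' measurableSet_Ioi).2 (Filter.Eventually.of_forall fun t ht => ?_)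
    have ht1 : γ + 1 < t := ht
    have ht0 : 0 < t := by linarith
    have hw := wgt_pos hγ (by linarith : γ < t)
    rw [Real.norm_of_nonneg (by positivity), Real.norm_of_nonneg (by positivity)]
    refine mul_le_mul_of_nonneg_left ?_ (by positivity)
    unfold wgt
    have : (t ^ 2 - γ ^ 2) ^ (-(1 / 2) : ℝ) ≤ 1 :=
      Real.rpow_le_one_of_one_le_of_nonpos (by nlinarith) (by norm_num)
    have he := Real.exp_pos (-t)
    nlinarith

lemma int_cubic {γ : ℝ} (hγ : 0 < γ) (a b c d : ℝ) :
    IntegrableOn (fun t : ℝ => (a + b * t + c * t ^ 2 + d * t ^ 3) * wgt γ t) (Set.Ioi γ) ∧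
    ∫ t in Set.Ioi γ, (a + b * t + c * t ^ 2 + d * t ^ 3) * wgt γ t =
      a * mom γ 0 + b * mom γ 1 + c * mom γ 2 + d * mom γ 3 := by
  have e : (fun t : ℝ => (a + b * t + c * t ^ 2 + d * t ^ 3) * wgt γ t) =
      fun t => a * (t ^ 0 * wgt γ t) + b * (t ^ 1 * wgt γ t) + c * (t ^ 2 * wgt γ t)
        + d * (t ^ 3 * wgt γ t) := by
    funext t; ring
  have h0 := (int_mom hγ 0).const_mul a
  have h1 := (int_mom hγ 1).const_mul b
  have h2 := (int_mom hγ 2).const_mul c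
  have h3 := (int_mom hγ 3).const_mul d
  rw [e]
  refine ⟨((h0.add h1).add h2).add h3, ?_⟩
  have h01 := integral_add h0 h1
  have h012 := integral_add (h0.add h1) h2
  have h0123 := integral_add ((h0.add h1).add h2) h3
  simp only [Pi.add_apply] at h01 h012 h0123
  rw [h0123, h012, h01]
  simp only [integral_const_mul, mom]

lemma ibp {γ : ℝ} (hγ : 0 < γ) (a b : ℝ) :
    (-b * γ ^ 2 + a * γ ^ 2) * mom γ 0 + (a + b * γ ^ 2) * mom γ 1 + (2 * b - a) * mom γ 2
      + (-b) * mom γ 3 = 0 := by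
  obtain ⟨hi, he⟩ := int_cubic hγ (-b * γ ^ 2 + a * γ ^ 2) (a + b * γ ^ 2) (2 * b - a) (-b)
  rw [← he]
  have key := integral_Ioi_of_hasDerivAt_of_tendsto (a := γ) (m := 0)
    (f := fun t : ℝ => (a + b * t) * (Real.exp (-t) * (t ^ 2 - γ ^ 2) ^ (1 / 2 : ℝ)))
    ?_ ?_ hi ?_
  · rw [key]
    norm_num
  · refine Continuous.continuousWithinAt ?_
    refine Continuous.mul (by fun_prop) (Continuous.mul (by fun_prop) ?_)
    exact Continuous.rpow_const (by fun_prop) (fun x => Or.inr (by norm_num))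
  · intro t ht
    have ht1 : γ < t := ht
    have hp : 0 < t ^ 2 - γ ^ 2 := by nlinarith
    have d1 : HasDerivAt (fun t : ℝ => a + b * t) b t := by
      simpa using ((hasDerivAt_id t).const_mul b).const_add a
    have d2 : HasDerivAt (fun t : ℝ => Real.exp (-t)) (-Real.exp (-t)) t := by
      simpa using (hasDerivAt_neg t).exp
    have d3 : HasDerivAt (fun t : ℝ => t ^ 2 - γ ^ 2) (2 * t) t := by
      simpa using (hasDerivAt_pow 2 t).sub_const (γ ^ 2)
    have d4 := d3.rpow_const (p := (1 / 2 : ℝ)) (Or.inl hp.ne')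
    refine (d1.mul (d2.mul d4)).congr_deriv ?_
    have e2 : (1 / 2 - 1 : ℝ) = -(1 / 2) := by norm_num
    simp only [wgt, e2, Pi.mul_apply]
    rw [half_eq hγ ht1]
    ring
  · have hb : Filter.Tendsto (fun t : ℝ => |a| * (t ^ 1 * Real.exp (-t)) +
        |b| * (t ^ 2 * Real.exp (-t))) Filter.atTop (nhds 0) := by
      have t1 := (Real.tendsto_pow_mul_exp_neg_atTop_nhds_zero 1).const_mul |a|
      have t2 := (Real.tendsto_pow_mul_exp_neg_atTop_nhds_zero 2).const_mul |b|
      simpa using t1.add t2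
    refine squeeze_zero_norm' ?_ hb
    filter_upwards [Filter.eventually_gt_atTop γ] with t ht
    have ht0 : 0 < t := by linarith
    have hs : (t ^ 2 - γ ^ 2) ^ (1 / 2 : ℝ) ≤ t := by
      rw [← Real.sqrt_eq_rpow]
      exact Real.sqrt_le_iff.2 ⟨ht0.le, by nlinarith⟩
    have hs0 : 0 ≤ (t ^ 2 - γ ^ 2) ^ (1 / 2 : ℝ) := by
      rw [← Real.sqrt_eq_rpow]
      exact Real.sqrt_nonneg _
    have hexp := Real.exp_pos (-t)
    rw [norm_mul, Real.norm_eq_abs, Real.norm_of_nonneg (by positivity)]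
    calc |a + b * t| * (Real.exp (-t) * (t ^ 2 - γ ^ 2) ^ (1 / 2 : ℝ))
        ≤ (|a| + |b| * t) * (Real.exp (-t) * t) := by
          refine mul_le_mul ?_ (by gcongr) (by positivity) (by positivity)
          calc |a + b * t| ≤ |a| + |b * t| := abs_add_le _ _
            _ = |a| + |b| * t := by rw [abs_mul, abs_of_pos ht0]
      _ = _ := by ring

lemma cubic_pos {γ : ℝ} (hγ : 0 < γ) (a b c d x : ℝ)
    (h : ∀ t, γ < t → t ≠ x → 0 < a + b * t + c * t ^ 2 + d * t ^ 3)
    (h' : ∀ t, γ < t → 0 ≤ a + b * t + c * t ^ 2 + d * t ^ 3) :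
    0 < a * mom γ 0 + b * mom γ 1 + c * mom γ 2 + d * mom γ 3 := by
  obtain ⟨hi, he⟩ := int_cubic hγ a b c d
  rw [← he, setIntegral_pos_iff_support_of_nonneg_ae ?_ hi]
  · have hsub : Set.Ioo (max γ x) (max γ x + 1) ⊆
        (Function.support fun t : ℝ => (a + b * t + c * t ^ 2 + d * t ^ 3) * wgt γ t) ∩
          Set.Ioi γ := by
      intro t ht
      have h1 : γ < t := lt_of_le_of_lt (le_max_left _ _) ht.1
      have h2 : x < t := lt_of_le_of_lt (le_max_right _ _) ht.1
      exact ⟨(mul_pos (h t h1 h2.ne') (wgt_pos hγ h1)).ne', h1⟩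
    refine lt_of_lt_of_le ?_ (measure_mono hsub)
    simp
  · refine (ae_restrict_iff' measurableSet_Ioi).2 (Filter.Eventually.of_forall fun t ht => ?_)
    exact mul_nonneg (h' t ht) (wgt_pos hγ ht).le

lemma K0_eq {γ : ℝ} : besselK 0 γ = mom γ 0 := by
  simp [besselK, mom, wgt]

lemma K1_eq {γ : ℝ} (hγ : 0 < γ) : besselK 1 γ = mom γ 1 / γ := by
  have h1 : ∫ t in Set.Ioi γ, Real.exp (-t) * (t ^ 2 - γ ^ 2) ^ (((1 : ℕ) : ℝ) - 1 / 2)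
      = mom γ 1 := by
    have h2 := (int_cubic hγ (-γ ^ 2) 0 1 0).2
    have h3 := ibp hγ 1 0
    have h4 : ∫ t in Set.Ioi γ, Real.exp (-t) * (t ^ 2 - γ ^ 2) ^ (((1 : ℕ) : ℝ) - 1 / 2)
        = ∫ t in Set.Ioi γ, (-γ ^ 2 + 0 * t + 1 * t ^ 2 + 0 * t ^ 3) * wgt γ t := by
      refine setIntegral_congr_fun measurableSet_Ioi (fun t ht => ?_)
      have e : (((1 : ℕ) : ℝ) - 1 / 2) = 1 / 2 := by norm_num
      simp only [e, wgt]
      rw [half_eq hγ ht]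
      ring
    rw [h4, h2]
    linarith
  unfold besselK
  rw [h1]
  norm_num [Real.rpow_neg_one]
  ring

lemma algebra_bound (g Q : ℝ) (hg : 0 < g) (h0 : 0 ≤ Q)
    (h : Q * (4 * g ^ 2 + 3 * g + 1) ≤ 4 * g ^ 2 + g + 1) :
    0 < g ^ 2 * (1 - Q ^ 2) ^ 2 - 11 * Q ^ 2 - (9 / g) * Q + 10 + 12 / g ^ 2 := by
  have hD : 0 < 4 * g ^ 2 + 3 * g + 1 := by positivity
  set U := (4 * g ^ 2 + g + 1) / (4 * g ^ 2 + 3 * g + 1) with hU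
  have hQU : Q ≤ U := by rw [hU, le_div_iff₀ hD]; exact h
  have hU1 : U ≤ 1 := by rw [hU, div_le_one hD]; linarith
  have hsq : Q ^ 2 ≤ U ^ 2 := by gcongr
  have hU2 : U ^ 2 ≤ 1 := by nlinarith
  have h1 : (1 - U ^ 2) ^ 2 ≤ (1 - Q ^ 2) ^ 2 :=
    pow_le_pow_left₀ (by linarith) (by linarith) 2
  have h2 : g ^ 2 * (1 - U ^ 2) ^ 2 ≤ g ^ 2 * (1 - Q ^ 2) ^ 2 := by gcongr
  have h3 : (9 / g) * Q ≤ (9 / g) * U := by gcongr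
  have h4 : 0 < g ^ 2 * (1 - U ^ 2) ^ 2 - 11 * U ^ 2 - (9 / g) * U + 10 + 12 / g ^ 2 := by
    have : g ^ 2 * (1 - U ^ 2) ^ 2 - 11 * U ^ 2 - (9 / g) * U + 10 + 12 / g ^ 2 =
      (12 + 135 * g + 749 * g ^ 2 + 2588 * g ^ 3 + 6024 * g ^ 4 + 9597 * g ^ 5 + 10191 * g ^ 6
        + 6592 * g ^ 7 + 2016 * g ^ 8) / (g ^ 2 * (4 * g ^ 2 + 3 * g + 1) ^ 4) := by
      rw [hU]
      field_simp
      ring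
    rw [this]
    positivity
  linarith

theorem diatomic_genuine_nonlinearity (γ : ℝ) (hγ : 0 < γ) :
    0 < γ ^ 2 * (1 - (besselK 0 γ / besselK 1 γ) ^ 2) ^ 2
        - 11 * (besselK 0 γ / besselK 1 γ) ^ 2
        - (9 / γ) * (besselK 0 γ / besselK 1 γ) + 10 + 12 / γ ^ 2 := by
  have hm0 : 0 < mom γ 0 := by
    simpa using cubic_pos hγ 1 0 0 0 0 (by intros; norm_num) (by intros; norm_num)
  have hm1 : 0 < mom γ 1 := by
    simpa using cubic_pos hγ 0 1 0 0 0 (by intros; linarith) (by intros; linarith)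
  have hK1 : 0 < besselK 1 γ := by rw [K1_eq hγ]; positivity
  have hK0 : 0 < besselK 0 γ := by rw [K0_eq]; exact hm0
  have hJ : mom γ 1 = γ * besselK 1 γ := by rw [K1_eq hγ]; field_simp
  apply algebra_bound _ _ hγ (by positivity)
  have i1 := ibp hγ 1 0
  have i2 := ibp hγ 0 1
  -- the polynomial `(t - γ) (t - γ - 1)²`
  have hc := cubic_pos hγ (-γ * (γ + 1) ^ 2) ((γ + 1) ^ 2 + 2 * γ * (γ + 1)) (-(3 * γ + 2)) 1
    (γ + 1)
    (fun t ht hne => by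
      have h1 : 0 < (t - (γ + 1)) ^ 2 := by
        have := sub_ne_zero.2 hne
        positivity
      have h2 := mul_pos (sub_pos.2 ht) h1
      linarith)
    (fun t ht => by
      have h2 := mul_nonneg (sub_pos.2 ht).le (sq_nonneg (t - (γ + 1)))
      linarith)
  have e2 : mom γ 2 = mom γ 1 + γ ^ 2 * mom γ 0 := by linarith
  have e3 : mom γ 3 = 2 * mom γ 2 + γ ^ 2 * mom γ 1 - γ ^ 2 * mom γ 0 := by linarith
  rw [e3, e2, hJ, ← K0_eq] at hc
  have hc' : 0 < γ * ((4 * γ ^ 2 + γ + 1) * besselK 1 γ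
      - (4 * γ ^ 2 + 3 * γ + 1) * besselK 0 γ) := by linarith
  have hc2 := (mul_pos_iff_of_pos_left hγ).1 hc'
  rw [div_mul_eq_mul_div, div_le_iff₀ hK1]
  linarith
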